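/- Let R = (r_{st}) be an n×n matrix over the complex numbers. For 1 ≤ i, j ≤ n, let R_{ij} be the matrix obtained from R by replacing the (i,j) entry by 0. Then (n² − n)·d₂(R) = Σ_{1 ≤ i, j ≤ n} d₂(R_{ij}), where the sum runs over all n² ordered pairs (i,j). -/

import Mathlib

open Matrix Finset

/-- The second immanant `d₂(M) = Σ_i M i i * det (M(i)) - det M`, where `M(i)` is the
submatrix of `M` obtained by deleting row `i` and column `i`. -/
noncomputable def d2 {α : Type*} [Fintype α] [DecidableEq α] (M : Matrix α α ℂ) : ℂ :=
  (∑ i, M i i *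
    (M.submatrix (fun k : {k : α // k ≠ i} => (k : α))
      (fun k : {k : α // k ≠ i} => (k : α))).det) - M.det

/-- Expanding the product of a diagonal entry with the complementary principal minor picks out
the permutations fixing the corresponding index. -/
theorem diag_mul_det_principal_minor {α : Type*} [Fintype α] [DecidableEq α]
    (M : Matrix α α ℂ) (i : α) :
    M i i * (M.submatrix (fun k : {k : α // k ≠ i} => (k : α))
        (fun k : {k : α // k ≠ i} => (k : α))).det
      = ∑ σ : Equiv.Perm α, (if σ i = i then (1 : ℂ) else 0) *
          ((Equiv.Perm.sign σ : ℤ) : ℂ) * ∏ k, M (σ k) k := by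
  set N : Matrix α α ℂ := Matrix.of fun a b => if a = i ∧ b ≠ i then 0 else M a b with hN
  have hblock := Matrix.twoBlockTriangular_det N (fun k => k ≠ i) (by
    intro a ha b hb
    simp only [not_not] at ha
    simp [hN, ha, hb])
  have hminor : N.toSquareBlockProp (fun k => k ≠ i)
      = M.submatrix (fun k : {k : α // k ≠ i} => (k : α))
        (fun k : {k : α // k ≠ i} => (k : α)) := by
    ext a b
    simp [hN, Matrix.toSquareBlockProp, a.2]
  have hentry : (N.toSquareBlockProp (fun k => ¬ k ≠ i)).det = M i i := by
    have : Unique {k : α // ¬ k ≠ i} :=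
      ⟨⟨⟨i, by simp⟩⟩, fun a => Subtype.ext (not_not.mp a.2)⟩
    have hdefault : ((default : {k : α // ¬ k ≠ i}) : α) = i :=
      not_not.mp (default : {k : α // ¬ k ≠ i}).2
    rw [Matrix.det_unique]
    simp [hN, Matrix.toSquareBlockProp, hdefault]
  rw [hminor, hentry, mul_comm] at hblock
  rw [← hblock, Matrix.det_apply']
  refine Finset.sum_congr rfl fun σ _ => ?_
  by_cases hσ : σ i = i
  · rw [if_pos hσ, one_mul]
    congr 1
    refine Finset.prod_congr rfl fun k _ => ?_
    have hk : ¬ (σ k = i ∧ k ≠ i) := fun h => h.2 (σ.injective (h.1.trans hσ.symm))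
    simp only [hN, Matrix.of_apply, if_neg hk]
  · rw [if_neg hσ, zero_mul, zero_mul, Finset.prod_eq_zero (Finset.mem_univ (σ.symm i)), mul_zero]
    have hk : σ.symm i ≠ i := fun h => hσ ((Equiv.symm_apply_eq σ).mp h).symm
    simp [hN, hk]

/-- The second immanant as a sum over permutations, weighted by the character
`sign σ * (#fixed points - 1)`. -/
theorem d2_eq_sum_perm {α : Type*} [Fintype α] [DecidableEq α] (M : Matrix α α ℂ) :
    d2 M = ∑ σ : Equiv.Perm α, ((∑ i, if σ i = i then (1 : ℂ) else 0) - 1) *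
      ((Equiv.Perm.sign σ : ℤ) : ℂ) * ∏ k, M (σ k) k := by
  simp only [d2, diag_mul_det_principal_minor]
  rw [Finset.sum_comm, Matrix.det_apply', ← Finset.sum_sub_distrib]
  refine Finset.sum_congr rfl fun σ _ => ?_
  rw [← Finset.sum_mul, ← Finset.sum_mul]
  ring

/-- Zeroing the `(i, j)` entry kills exactly the monomials of permutations with `σ j = i`. -/
theorem prod_zeroed_entry {α : Type*} [Fintype α] [DecidableEq α] (R : Matrix α α ℂ)
    (σ : Equiv.Perm α) (i j : α) :
    ∏ k, (Matrix.of fun a b => if a = i ∧ b = j then (0 : ℂ) else R a b) (σ k) k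
      = (1 - if i = σ j then 1 else 0) * ∏ k, R (σ k) k := by
  by_cases h : i = σ j
  · rw [if_pos h, sub_self, zero_mul]
    exact Finset.prod_eq_zero (Finset.mem_univ j) (by simp [h])
  · rw [if_neg h, sub_zero, one_mul]
    refine Finset.prod_congr rfl fun k _ => ?_
    have hk : ¬ (σ k = i ∧ k = j) := by
      rintro ⟨rfl, rfl⟩
      exact h rfl
    simp only [Matrix.of_apply, if_neg hk]

/-- Let `R` be an `n × n` matrix over `ℂ`. For indices `i, j`, let `R_{ij}` be
the matrix obtained from `R` by replacing the `(i,j)` entry by `0`. Then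
`(n² - n) * d₂(R) = Σ_{1 ≤ i,j ≤ n} d₂(R_{ij})`, the sum running over all `n²` ordered
pairs `(i, j)`. -/
theorem d2_sum_zeroed_entries {n : ℕ} (R : Matrix (Fin n) (Fin n) ℂ) :
    ((n : ℂ) ^ 2 - (n : ℂ)) * d2 R
      = ∑ i : Fin n, ∑ j : Fin n,
          d2 (Matrix.of fun a b => if a = i ∧ b = j then (0 : ℂ) else R a b) := by
  simp only [d2_eq_sum_perm, prod_zeroed_entry]
  rw [Finset.mul_sum, Finset.sum_congr rfl fun i _ => Finset.sum_comm, Finset.sum_comm]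
  refine Finset.sum_congr rfl fun σ _ => ?_
  have hcount : ∑ i : Fin n, ∑ j : Fin n, ((1 : ℂ) - if i = σ j then 1 else 0)
      = (n : ℂ) ^ 2 - n := by
    rw [Finset.sum_comm]
    simp [Finset.sum_sub_distrib]
    ring
  simp only [← Finset.mul_sum, ← Finset.sum_mul]
  rw [hcount]
  ring
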